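/- There is no graph G with a vertex v such that γ_g(G) = 4 and γ_g(G−v) = 2. -/

import Mathlib

open Classical

noncomputable section

namespace DomGame

variable {V : Type*} [Fintype V]

/-- Closed neighborhood of `v` as a `Finset`. -/
noncomputable def N (G : SimpleGraph V) (v : V) : Finset V :=
  Finset.univ.filter (fun u => G.Adj v u ∨ u = v)

/-- Legal moves given the set `S` of already dominated vertices. -/
noncomputable def moves (G : SimpleGraph V) (S : Finset V) : Finset V :=
  Finset.univ.filter (fun v => ¬ N G v ⊆ S)

lemma card_lt {G : SimpleGraph V} {S : Finset V} (v : V) (hv : v ∈ moves G S) :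
    (Finset.univ \ (S ∪ N G v)).card < (Finset.univ \ S).card := by
  simp only [moves, Finset.mem_filter] at hv
  obtain ⟨u, hu, hus⟩ := Finset.not_subset.mp hv.2
  apply Finset.card_lt_card
  refine ⟨Finset.sdiff_subset_sdiff (le_refl _) Finset.subset_union_left, ?_⟩
  intro hsub
  have := hsub (Finset.mem_sdiff.mpr ⟨Finset.mem_univ u, hus⟩)
  rw [Finset.mem_sdiff, Finset.mem_union] at this
  exact this.2 (Or.inr hu)

mutual
/-- Number of moves with optimal play when it is Dominator's turn and
`S` is the set of already dominated vertices. -/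
noncomputable def gameD (G : SimpleGraph V) (S : Finset V) : ℕ :=
  if h : (moves G S).Nonempty then
    1 + (moves G S).attach.inf' (by simpa using h)
      (fun v => gameS G (S ∪ N G v.1))
  else 0
termination_by (Finset.univ \ S).card
decreasing_by exact card_lt v.1 v.2

/-- Number of moves with optimal play when it is Staller's turn. -/
noncomputable def gameS (G : SimpleGraph V) (S : Finset V) : ℕ :=
  if h : (moves G S).Nonempty then
    1 + (moves G S).attach.sup' (by simpa using h)
      (fun v => gameD G (S ∪ N G v.1))
  else 0
termination_by (Finset.univ \ S).card
decreasing_by exact card_lt v.1 v.2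
end

/-- The (Dominator-start) game domination number. -/
noncomputable def gammaG (G : SimpleGraph V) : ℕ := gameD G ∅

/-- The Staller-start game domination number. -/
noncomputable def gammaG' (G : SimpleGraph V) : ℕ := gameS G ∅

end DomGame

namespace DomGame

variable {V : Type*} [Fintype V]

lemma mem_N {G : SimpleGraph V} {a b : V} : b ∈ N G a ↔ G.Adj a b ∨ b = a := by
  simp [N]

lemma self_mem_N (G : SimpleGraph V) (a : V) : a ∈ N G a := mem_N.2 (Or.inr rfl)

lemma mem_moves {G : SimpleGraph V} {S : Finset V} {a : V} : a ∈ moves G S ↔ ¬ N G a ⊆ S := by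
  simp [moves]

lemma gameD_le {G : SimpleGraph V} {S : Finset V} {x : V} (hx : x ∈ moves G S) :
    gameD G S ≤ 1 + gameS G (S ∪ N G x) := by
  rw [gameD, dif_pos ⟨x, hx⟩]
  exact Nat.add_le_add_left
    (Finset.inf'_le (fun w : moves G S => gameS G (S ∪ N G w.1)) (Finset.mem_attach _ ⟨x, hx⟩)) 1

lemma gameS_le {G : SimpleGraph V} {S : Finset V} {k : ℕ}
    (h : ∀ y ∈ moves G S, gameD G (S ∪ N G y) ≤ k) : gameS G S ≤ 1 + k := by
  rw [gameS]
  split_ifs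
  · exact Nat.add_le_add_left (Finset.sup'_le _ _ fun w _ => h w.1 w.2) 1
  · exact Nat.zero_le _

lemma le_gameS {G : SimpleGraph V} {S : Finset V} {y : V} (hy : y ∈ moves G S) :
    1 + gameD G (S ∪ N G y) ≤ gameS G S := by
  rw [gameS, dif_pos ⟨y, hy⟩]
  exact Nat.add_le_add_left
    (Finset.le_sup' (fun w : moves G S => gameD G (S ∪ N G w.1)) (Finset.mem_attach _ ⟨y, hy⟩)) 1

lemma exists_gameD_eq {G : SimpleGraph V} {S : Finset V} (h : gameD G S ≠ 0) :
    ∃ x, gameD G S = 1 + gameS G (S ∪ N G x) := by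
  rw [gameD] at h ⊢
  split_ifs at h ⊢ with hne
  · obtain ⟨x, -, hx⟩ := Finset.exists_mem_eq_inf' (s := (moves G S).attach) (by simpa using hne)
      (fun w => gameS G (S ∪ N G w.1))
    exact ⟨x.1, by rw [hx]⟩
  · exact absurd rfl h

lemma eq_univ_of_gameD_eq_zero {G : SimpleGraph V} {S : Finset V} (h : gameD G S = 0) :
    S = Finset.univ := by
  by_contra hS
  obtain ⟨u, hu⟩ : ∃ u, u ∉ S := by simpa [Finset.eq_univ_iff_forall] using hS
  rw [gameD, dif_pos ⟨u, mem_moves.2 fun hsub => hu (hsub (self_mem_N G u))⟩] at h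
  omega

lemma gameS_univ (G : SimpleGraph V) : gameS G Finset.univ = 0 := by
  rw [gameS, dif_neg]
  rintro ⟨u, hu⟩
  exact mem_moves.1 hu (Finset.subset_univ _)

lemma gameD_univ (G : SimpleGraph V) : gameD G Finset.univ = 0 := by
  rw [gameD, dif_neg]
  rintro ⟨u, hu⟩
  exact mem_moves.1 hu (Finset.subset_univ _)

lemma gameD_le_one {G : SimpleGraph V} {S : Finset V} {u : V}
    (h : S ∪ N G u = Finset.univ) : gameD G S ≤ 1 := by
  by_cases hu : u ∈ moves G S
  · simpa [h, gameS_univ] using gameD_le hu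
  · rw [mem_moves, not_not] at hu
    rw [Finset.union_eq_left.2 hu] at h
    simp [h, gameD_univ]

/-- If `γ_g(G) = 2`, Dominator has a first move after which every legal reply ends the game. -/
lemma exists_move_of_gammaG_eq_two {G : SimpleGraph V} (h : gammaG G = 2) :
    ∃ x, ∀ y, ¬ N G y ⊆ N G x → N G x ∪ N G y = Finset.univ := by
  unfold gammaG at h
  obtain ⟨x, hx⟩ := exists_gameD_eq (G := G) (S := ∅) (by omega)
  rw [Finset.empty_union] at hx
  refine ⟨x, fun y hy => eq_univ_of_gameD_eq_zero (G := G) ?_⟩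
  have := le_gameS (mem_moves.2 hy)
  omega

lemma gammaG_le_three {G : SimpleGraph V} (x : V)
    (h : ∀ y, ¬ N G y ⊆ N G x → ∃ u, N G x ∪ N G y ∪ N G u = Finset.univ) : gammaG G ≤ 3 := by
  have hx : x ∈ moves G ∅ := mem_moves.2 fun hsub => by simpa using hsub (self_mem_N G x)
  have hD := gameD_le hx
  rw [Finset.empty_union] at hD
  have hS : gameS G (N G x) ≤ 1 + 1 := gameS_le fun y hy =>
    let ⟨_, hu⟩ := h y (mem_moves.1 hy)
    gameD_le_one hu
  unfold gammaG
  omega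

lemma gammaG_le_three_of_induce_compl_singleton {G : SimpleGraph V} {v : V}
    (h : gammaG (G.induce {v}ᶜ) = 2) : gammaG G ≤ 3 := by
  obtain ⟨x, hx⟩ := exists_move_of_gammaG_eq_two h
  have mem_iff (a b : ({v}ᶜ : Set V)) : b ∈ N (G.induce {v}ᶜ) a ↔ b.1 ∈ N G a.1 := by
    simp [mem_N, Subtype.ext_iff]
  have cover {y : ({v}ᶜ : Set V)} (hy : ¬ N (G.induce {v}ᶜ) y ⊆ N (G.induce {v}ᶜ) x)
      {a : V} (ha : a ≠ v) : a ∈ N G x.1 ∨ a ∈ N G y.1 := by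
    have := Finset.eq_univ_iff_forall.1 (hx y hy) ⟨a, ha⟩
    simpa [mem_iff] using this
  have finish : ∃ u, ∀ a, a ≠ v → a ∈ N G x.1 ∨ a ∈ N G u := by
    by_cases hall : ∀ a, a ≠ v → a ∈ N G x.1
    · exact ⟨v, fun a ha => Or.inl (hall a ha)⟩
    · push Not at hall
      obtain ⟨u, huv, hu⟩ := hall
      exact ⟨u, fun a ha => cover (y := ⟨u, huv⟩)
        (fun hsub => hu ((mem_iff _ _).1 (hsub (self_mem_N _ _)))) ha⟩
  refine gammaG_le_three x.1 fun y hy => ?_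
  by_cases hvy : v ∈ N G y
  · obtain ⟨u, hu⟩ := finish
    refine ⟨u, Finset.eq_univ_iff_forall.2 fun a => ?_⟩
    rcases eq_or_ne a v with rfl | ha
    · simp [hvy]
    · rcases hu a ha with h | h <;> simp [h]
  · have hyv : y ≠ v := fun e => hvy (e ▸ self_mem_N G y)
    refine ⟨v, Finset.eq_univ_iff_forall.2 fun a => ?_⟩
    rcases eq_or_ne a v with rfl | ha
    · simp [self_mem_N]
    · have hy' : ¬ N (G.induce {v}ᶜ) ⟨y, hyv⟩ ⊆ N (G.induce {v}ᶜ) x := by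
        refine fun hsub => hy fun b hb => ?_
        have hbv : b ≠ v := fun e => hvy (e ▸ hb)
        exact (mem_iff x ⟨b, hbv⟩).1 (hsub ((mem_iff ⟨y, hyv⟩ ⟨b, hbv⟩).2 hb))
      rcases cover hy' ha with h | h <;> simp [h]

end DomGame

open DomGame in
/-- There is no graph `G` with a vertex `v` such that `γ_g(G) = 4` and
`γ_g(G−v) = 2`. -/
theorem no_gameD_four_to_two {V : Type*} [Fintype V] (G : SimpleGraph V) (v : V) :
    ¬ (gammaG G = 4 ∧ gammaG (G.induce {v}ᶜ) = 2) := by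
  rintro ⟨h4, h2⟩
  have := gammaG_le_three_of_induce_compl_singleton h2
  omega
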